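/- Let B10(θ̂) be the conjugate-prior Bayes factor defined below with ν0 = ν1 = ν and s0 = s1. Then for every θ̂, the ratio θ̂ᵀQθ̂ / θ̂ᵀ(Q⁻¹ + Ω)⁻¹θ̂ ≤ 1 + λ_max, where λ_max is the largest eigenvalue of QΩ, and consequently limsup_{|θ̂|→∞} B10(θ̂) ≤ C1 · (1 + λ_max)^{(n+ν−r2)/2} < ∞, where C1 = |I + QΩ|^{−1/2}; in particular B10 remains bounded as |θ̂| → ∞ (information inconsistency). -/

import Mathlib

open MeasureTheory Filter Matrix

open scoped MatrixOrder in
lemma aux_form {r : ℕ} (Q Ω : Matrix (Fin r) (Fin r) ℝ) (hQ : Q.PosDef) (hΩ : Ω.PosDef)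
    (l : ℝ) (hmem : l ∈ spectrum ℝ (Q * Ω)) (hmax : ∀ μ ∈ spectrum ℝ (Q * Ω), μ ≤ l) :
    0 ≤ l ∧ ∀ x : Fin r → ℝ, (Q *ᵥ x) ⬝ᵥ Ω *ᵥ (Q *ᵥ x) ≤ l * (x ⬝ᵥ Q *ᵥ x) := by
  obtain ⟨B, rfl⟩ := CStarAlgebra.nonneg_iff_eq_star_mul_self.mp hQ.posSemidef.nonneg
  rw [star_eq_conjTranspose] at *
  have hM : (B * Ω * Bᴴ).PosSemidef := hΩ.posSemidef.mul_mul_conjTranspose_same B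
  have hsp := spectrum.nonzero_mul_comm (𝕜 := ℝ) Bᴴ (B * Ω)
  rw [← mul_assoc] at hsp
  have hMs := (posSemidef_iff_isHermitian_and_spectrum_nonneg.mp hM).2
  have hl : 0 ≤ l := by
    by_cases h0 : l = 0
    · exact h0.ge
    · have : l ∈ spectrum ℝ (Bᴴ * B * Ω) \ {0} := ⟨hmem, h0⟩
      rw [hsp] at this
      exact hMs this.1
  refine ⟨hl, fun x => ?_⟩
  have hP : (algebraMap ℝ (Matrix (Fin r) (Fin r) ℝ) l - B * Ω * Bᴴ).PosSemidef := by
    rw [posSemidef_iff_isHermitian_and_spectrum_nonneg]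
    refine ⟨?_, ?_⟩
    · refine IsHermitian.sub ?_ hM.1
      rw [Matrix.algebraMap_eq_diagonal]
      exact isHermitian_diagonal _
    · rw [← spectrum.singleton_sub_eq]
      rintro a ⟨b, hb, c, hc, rfl⟩
      rw [Set.mem_singleton_iff] at hb
      subst hb
      have : c ≤ b := by
        by_cases h0 : c = 0
        · rw [h0]; exact hl
        · have : c ∈ spectrum ℝ (B * Ω * Bᴴ) \ {0} := ⟨hc, h0⟩
          rw [← hsp] at this
          exact hmax _ this.1
      exact sub_nonneg.mpr this
  have h := hP.dotProduct_mulVec_nonneg (B *ᵥ x)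
  rw [Algebra.algebraMap_eq_smul_one, sub_mulVec, smul_mulVec, one_mulVec, dotProduct_sub,
    dotProduct_smul, sub_nonneg, smul_eq_mul] at h
  have e1 : (Bᴴ * B) *ᵥ x ⬝ᵥ Ω *ᵥ (Bᴴ * B) *ᵥ x = star (B *ᵥ x) ⬝ᵥ (B * Ω * Bᴴ) *ᵥ B *ᵥ x := by
    rw [star_trivial, conjTranspose_eq_transpose_of_trivial, ← mulVec_mulVec, ← mulVec_mulVec,
      ← mulVec_mulVec, dotProduct_mulVec (B *ᵥ x) B, ← mulVec_transpose]
  have e2 : x ⬝ᵥ (Bᴴ * B) *ᵥ x = star (B *ᵥ x) ⬝ᵥ B *ᵥ x := by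
    rw [star_trivial, conjTranspose_eq_transpose_of_trivial, ← mulVec_mulVec,
      dotProduct_mulVec x, vecMul_transpose]
  rw [e1, e2]
  exact h

lemma aux_ratio {r : ℕ} (Q Ω : Matrix (Fin r) (Fin r) ℝ) (hQ : Q.PosDef) (hΩ : Ω.PosDef)
    (l : ℝ) (hmem : l ∈ spectrum ℝ (Q * Ω)) (hmax : ∀ μ ∈ spectrum ℝ (Q * Ω), μ ≤ l)
    (x : Fin r → ℝ) :
    x ⬝ᵥ Q *ᵥ x ≤ (1 + l) * (x ⬝ᵥ (Q⁻¹ + Ω)⁻¹ *ᵥ x) := by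
  obtain ⟨hl, h⟩ := aux_form Q Ω hQ hΩ l hmem hmax
  have hx := h x
  have hP : (Q⁻¹ + Ω).PosDef := hQ.inv.add hΩ
  have hPu : IsUnit (Q⁻¹ + Ω).det := hP.det_pos.ne'.isUnit
  have hQu : IsUnit Q.det := hQ.det_pos.ne'.isUnit
  have hPt : (Q⁻¹ + Ω)ᵀ = Q⁻¹ + Ω := by
    simpa [IsHermitian, conjTranspose_eq_transpose_of_trivial] using hP.1
  set P := Q⁻¹ + Ω with hPdef
  set y := P⁻¹ *ᵥ x with hy
  have hPy : P *ᵥ y = x := by simp [hy, mulVec_mulVec, mul_nonsing_inv _ hPu]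
  have hPz : (Q *ᵥ x) ⬝ᵥ P *ᵥ (Q *ᵥ x) = x ⬝ᵥ Q *ᵥ x + (Q *ᵥ x) ⬝ᵥ Ω *ᵥ (Q *ᵥ x) := by
    rw [hPdef, add_mulVec, dotProduct_add]
    congr 1
    rw [mulVec_mulVec, nonsing_inv_mul _ hQu, one_mulVec, dotProduct_comm]
  have hsymm : ∀ z, y ⬝ᵥ P *ᵥ z = x ⬝ᵥ z := by
    intro z
    rw [dotProduct_mulVec, ← mulVec_transpose, hPt, hPy]
  have h0 := hP.posSemidef.dotProduct_mulVec_nonneg ((1 + l) • y - Q *ᵥ x)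
  have e : star ((1 + l) • y - Q *ᵥ x) ⬝ᵥ P *ᵥ ((1 + l) • y - Q *ᵥ x)
      = (1 + l) ^ 2 * (x ⬝ᵥ y) - 2 * (1 + l) * (x ⬝ᵥ Q *ᵥ x)
        + (Q *ᵥ x) ⬝ᵥ P *ᵥ (Q *ᵥ x) := by
    simp only [star_trivial, mulVec_sub, mulVec_smul, dotProduct_sub, sub_dotProduct,
      dotProduct_smul, smul_dotProduct, hsymm, hPy, smul_eq_mul]
    rw [dotProduct_comm (Q *ᵥ x) x, dotProduct_comm y x]
    ring
  rw [e, hPz] at h0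
  have h1 : 0 < 1 + l := by linarith
  have : (1 + l) * (x ⬝ᵥ Q *ᵥ x) ≤ (1 + l) * ((1 + l) * (x ⬝ᵥ y)) := by nlinarith
  exact le_of_mul_le_mul_left this h1

/-- With ν0 = ν1 = ν and s0 = s1, the quadratic-form ratio is bounded by
1 + λ_max (λ_max the largest eigenvalue of QΩ), so the conjugate Bayes factor satisfies
limsup B10 ≤ C1 (1+λ_max)^{(n+ν−r2)/2} < ∞ as |θ̂| → ∞; in particular B10 remains bounded
(information inconsistency). -/
theorem conjugate_bayes_factor_information_inconsistent
    (n r1 r2 : ℕ) (hn : 1 ≤ n) (hr1 : 1 ≤ r1)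
    (Q Ω : Matrix (Fin r1) (Fin r1) ℝ) (hQ : Q.PosDef) (hΩ : Ω.PosDef)
    (ν : ℝ) (hν : 0 ≤ ν) (hdf : 0 < (n : ℝ) + ν - r2)
    (ssq : ℝ) (hs : 0 < ssq)
    (sysq : ℝ) (hsy : 0 < sysq)
    (lammax : ℝ)
    (hmem : lammax ∈ spectrum ℝ (Q * Ω))
    (hmax : ∀ μ ∈ spectrum ℝ (Q * Ω), μ ≤ lammax)
    (C1 : ℝ) (hC1 : C1 = (1 + Q * Ω).det ^ (-(1:ℝ)/2))
    (B10 : EuclideanSpace ℝ (Fin r1) → ℝ)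
    (hB10 : ∀ θhat : EuclideanSpace ℝ (Fin r1),
      B10 θhat = C1 *
        (ν * ssq + sysq + θhat ⬝ᵥ ((Q⁻¹ + Ω)⁻¹).mulVec θhat)
          ^ (-(((n:ℝ) + ν - r2) / 2)) /
        (ν * ssq + sysq + θhat ⬝ᵥ Q.mulVec θhat)
          ^ (-(((n:ℝ) + ν - r2) / 2))) :
    (∀ θhat : EuclideanSpace ℝ (Fin r1), θhat ≠ 0 →
      (θhat ⬝ᵥ Q.mulVec θhat) / (θhat ⬝ᵥ ((Q⁻¹ + Ω)⁻¹).mulVec θhat) ≤ 1 + lammax) ∧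
    (Filter.limsup B10 (comap (fun θhat : EuclideanSpace ℝ (Fin r1) => ‖θhat‖) atTop)
        ≤ C1 * (1 + lammax) ^ (((n:ℝ) + ν - r2) / 2)) ∧
    (∃ B : ℝ, ∀ᶠ θhat in comap (fun θhat : EuclideanSpace ℝ (Fin r1) => ‖θhat‖) atTop,
        B10 θhat ≤ B) := by
  obtain ⟨hl, -⟩ := aux_form Q Ω hQ hΩ lammax hmem hmax
  have hR := fun x => aux_ratio Q Ω hQ hΩ lammax hmem hmax x
  have hP : (Q⁻¹ + Ω).PosDef := hQ.inv.add hΩ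
  have hC : 0 ≤ C1 := by
    have hQu : IsUnit Q.det := hQ.det_pos.ne'.isUnit
    have : 1 + Q * Ω = Q * (Q⁻¹ + Ω) := by rw [mul_add, mul_nonsing_inv _ hQu]
    rw [hC1, this, det_mul]
    exact Real.rpow_nonneg (mul_pos hQ.det_pos hP.det_pos).le _
  have ha : ∀ x : Fin r1 → ℝ, 0 ≤ x ⬝ᵥ (Q⁻¹ + Ω)⁻¹ *ᵥ x := fun x => by
    simpa using hP.inv.posSemidef.dotProduct_mulVec_nonneg x
  have hb : ∀ x : Fin r1 → ℝ, 0 ≤ x ⬝ᵥ Q *ᵥ x := fun x => by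
    simpa using hQ.posSemidef.dotProduct_mulVec_nonneg x
  have hS : 0 < ν * ssq + sysq := by positivity
  have hbound : ∀ x, 0 ≤ B10 x ∧ B10 x ≤ C1 * (1 + lammax) ^ (((n:ℝ) + ν - r2) / 2) := by
    intro x
    have h1 := ha x
    have h2 := hb x
    have h3 := hR x
    rw [hB10]
    set a := x.ofLp ⬝ᵥ (Q⁻¹ + Ω)⁻¹ *ᵥ x.ofLp
    set b := x.ofLp ⬝ᵥ Q *ᵥ x.ofLp
    set S := ν * ssq + sysq
    have hSa : 0 < S + a := by linarith
    have hSb : 0 < S + b := by linarith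
    refine ⟨by positivity, ?_⟩
    rw [mul_div_assoc]
    refine mul_le_mul_of_nonneg_left ?_ hC
    rw [Real.rpow_neg hSa.le, Real.rpow_neg hSb.le, inv_div_inv, ← Real.div_rpow hSb.le hSa.le]
    refine Real.rpow_le_rpow (by positivity) ?_ (by linarith)
    rw [div_le_iff₀ hSa]
    nlinarith
  refine ⟨?_, ?_, ⟨_, Eventually.of_forall fun x => (hbound x).2⟩⟩
  · intro x _
    exact div_le_of_le_mul₀ (ha x) (by linarith) (hR x)
  · have : Nonempty (Fin r1) := ⟨⟨0, hr1⟩⟩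
    have hne : (comap (fun θhat : EuclideanSpace ℝ (Fin r1) => ‖θhat‖) atTop).NeBot := by
      rw [comap_norm_atTop]
      infer_instance
    refine limsup_le_of_le ?_ (Eventually.of_forall fun x => (hbound x).2)
    exact IsBoundedUnder.isCoboundedUnder_le
      (isBoundedUnder_of ⟨0, fun x => (hbound x).1⟩)
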